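/- For all nonnegative integers j, m and every positive integer N, b(N, j, m, ∞) = C(N(N-1)/2 + j - 1, j) · C(N + m - 1, m), where C(·,·) denotes the binomial coefficient. Equivalently: the number of semistandard Young tableaux of size 2j+m with exactly m odd columns and entries from {1,…,N} equals this product of binomial coefficients. -/

import Mathlib

open scoped Classical

noncomputable section

/-- Semistandard Young tableaux of shape `μ` with entries in `{1, …, N}`. -/
def SSYTN (N : ℕ) (μ : YoungDiagram) : Type :=
  {T : SemistandardYoungTableau μ // ∀ i j : ℕ, (i, j) ∈ μ → T i j ∈ Finset.Icc 1 N}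

/-- `d_λ(N)`: the number of semistandard Young tableaux of shape `μ`
with entries in `{1, …, N}`. -/
def dCount (N : ℕ) (μ : YoungDiagram) : ℕ := Nat.card (SSYTN N μ)

/-- `f(λ')`: the number of odd columns of `μ`. -/
def oddCols (μ : YoungDiagram) : ℕ :=
  ((Finset.range μ.card).filter fun j => Odd (μ.colLen j)).card

/-- `ℓ(λ)`: the number of rows of `μ` (the length of its first column). -/
def numRows (μ : YoungDiagram) : ℕ := μ.colLen 0

/-- `b(N, j, m, ∞)`: the number of semistandard Young tableaux of size `2j+m`
with exactly `m` odd columns and entries from `{1, …, N}`. -/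
def bInf (N j m : ℕ) : ℕ :=
  Nat.card (Σ μ : {μ : YoungDiagram // μ.card = 2 * j + m ∧ oddCols μ = m}, SSYTN N μ.1)

open scoped ENNReal

namespace YoungDiagram

theorem ext_rowLen {μ ν : YoungDiagram} (h : ∀ i, μ.rowLen i = ν.rowLen i) : μ = ν := by
  ext ⟨i, j⟩
  rw [mem_cells, mem_cells, mem_iff_lt_rowLen, mem_iff_lt_rowLen, h]

theorem rowLen_eq_of_forall_mem_iff {μ : YoungDiagram} {i n : ℕ}
    (h : ∀ j, (i, j) ∈ μ ↔ j < n) : μ.rowLen i = n := by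
  have h' : ∀ j, j < μ.rowLen i ↔ j < n := fun j => by rw [← mem_iff_lt_rowLen, h]
  exact le_antisymm (not_lt.1 fun hlt => lt_irrefl _ ((h' _).1 hlt))
    (not_lt.1 fun hlt => lt_irrefl _ ((h' _).2 hlt))

/-- An antitone eventually vanishing sequence is the sequence of row lengths of a diagram. -/
theorem exists_rowLen_eq {f : ℕ → ℕ} (hf : Antitone f) {M : ℕ} (hM : f M = 0) :
    ∃ μ : YoungDiagram, ∀ i, μ.rowLen i = f i := by
  have hbound : ∀ i, M ≤ i → f i = 0 := fun i h => Nat.le_zero.1 (hM ▸ hf h)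
  have hmem : ∀ i j,
      (i, j) ∈ (Finset.range M ×ˢ Finset.range (f 0)).filter (fun c => c.2 < f c.1) ↔ j < f i := by
    intro i j
    rw [Finset.mem_filter, Finset.mem_product, Finset.mem_range, Finset.mem_range]
    have h0 := hf (Nat.zero_le i)
    have h1 := hbound i
    dsimp only
    omega
  have hlow : IsLowerSet (((Finset.range M ×ˢ Finset.range (f 0)).filter
      fun c => c.2 < f c.1 : Finset (ℕ × ℕ)) : Set (ℕ × ℕ)) := by
    rintro ⟨a, b⟩ ⟨c, d⟩ hcd hab
    obtain ⟨h1, h2⟩ := Prod.mk_le_mk.1 hcd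
    have := hf h1
    rw [Finset.mem_coe, hmem] at hab ⊢
    omega
  exact ⟨⟨_, hlow⟩, fun i => rowLen_eq_of_forall_mem_iff fun j => hmem i j⟩

theorem exists_forall_rowLen_eq_zero (μ : YoungDiagram) : ∃ M, ∀ i, M ≤ i → μ.rowLen i = 0 := by
  refine ⟨μ.colLen 0, fun i hi => ?_⟩
  by_contra h
  exact absurd (mem_iff_lt_colLen.1 (mem_iff_lt_rowLen.2 (Nat.pos_of_ne_zero h))) (not_lt.2 hi)

theorem card_eq_sum_rowLen (μ : YoungDiagram) {M : ℕ} (hM : μ.rowLen M = 0) :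
    μ.card = ∑ i ∈ Finset.range M, μ.rowLen i := by
  have hmaps : ∀ c ∈ μ.cells, c.1 ∈ Finset.range M := by
    rintro ⟨i, j⟩ hc
    rw [mem_cells, mem_iff_lt_rowLen] at hc
    by_contra h
    have := μ.rowLen_anti M i (by simpa using h)
    omega
  rw [YoungDiagram.card, Finset.card_eq_sum_card_fiberwise hmaps]
  refine Finset.sum_congr rfl fun i _ => ?_
  rw [rowLen_eq_card]
  rfl

theorem oddCols_eq_sum (μ : YoungDiagram) {M : ℕ} (hM : μ.rowLen M = 0) :
    (oddCols μ : ℤ) = ∑ i ∈ Finset.range M, (-1) ^ i * (μ.rowLen i : ℤ) := by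
  have halt : ∀ n : ℕ, (if Odd n then 1 else 0 : ℤ) = ∑ i ∈ Finset.range n, (-1 : ℤ) ^ i := by
    intro n
    rw [neg_one_geom_sum]
    by_cases h : Even n
    · simp [h]
    · simp [h, Nat.not_even_iff_odd.1 h]
  have hcol : ∀ j, μ.colLen j ≤ M := by
    intro j
    by_contra h
    have := mem_iff_lt_rowLen.1 (mem_iff_lt_colLen.2 (not_le.1 h))
    omega
  have hrow : ∀ i, μ.rowLen i ≤ μ.card := by
    intro i
    rw [rowLen_eq_card]
    exact Finset.card_le_card (Finset.filter_subset _ _)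
  have key : ∀ j, (∑ i ∈ Finset.range (μ.colLen j), (-1 : ℤ) ^ i)
      = ∑ i ∈ Finset.range M, if (i, j) ∈ μ then (-1 : ℤ) ^ i else 0 := by
    intro j
    rw [← Finset.sum_filter]
    refine Finset.sum_congr ?_ fun _ _ => rfl
    ext i
    have := hcol j
    simp only [Finset.mem_filter, Finset.mem_range, mem_iff_lt_colLen]
    omega
  rw [oddCols, Finset.card_filter]
  push_cast
  simp_rw [halt, key]
  rw [Finset.sum_comm]
  refine Finset.sum_congr rfl fun i _ => ?_
  rw [← Finset.sum_filter, Finset.sum_const, nsmul_eq_mul, mul_comm]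
  congr 2
  rw [← Finset.card_range (μ.rowLen i)]
  congr 1
  ext j
  have := hrow i
  simp only [Finset.mem_filter, Finset.mem_range, mem_iff_lt_rowLen]
  omega

theorem exists_card_eq_two_mul_add_oddCols (μ : YoungDiagram) :
    ∃ j, μ.card = 2 * j + oddCols μ := by
  obtain ⟨M, hM⟩ := μ.exists_forall_rowLen_eq_zero
  have h1 := μ.card_eq_sum_rowLen (hM M le_rfl)
  have h2 := μ.oddCols_eq_sum (hM M le_rfl)
  have hle : oddCols μ ≤ μ.card := (Finset.card_filter_le _ _).trans (by simp)
  have hdvd : (2 : ℤ) ∣ (μ.card : ℤ) - oddCols μ := by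
    rw [h1, h2]
    push_cast
    rw [← Finset.sum_sub_distrib]
    refine Finset.dvd_sum fun i _ => ?_
    rcases neg_one_pow_eq_or ℤ i with h | h <;> rw [h]
    · simp
    · exact ⟨μ.rowLen i, by ring⟩
  exact ⟨(μ.card - oddCols μ) / 2, by omega⟩

/-- `μ` is obtained from `ν` by removing a horizontal strip. -/
def Interlaces (μ ν : YoungDiagram) : Prop :=
  ∀ i, μ.rowLen i ≤ ν.rowLen i ∧ ν.rowLen (i + 1) ≤ μ.rowLen i

theorem Interlaces.card_le {μ ν : YoungDiagram} (h : μ.Interlaces ν) : μ.card ≤ ν.card := by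
  obtain ⟨M, hM⟩ := ν.exists_forall_rowLen_eq_zero
  have hν := hM M le_rfl
  have hμ : μ.rowLen M = 0 := Nat.le_zero.1 (hν ▸ (h M).1)
  rw [card_eq_sum_rowLen μ hμ, card_eq_sum_rowLen ν hν]
  exact Finset.sum_le_sum fun i _ => (h i).1

theorem rowLen_bot (i : ℕ) : (⊥ : YoungDiagram).rowLen i = 0 :=
  rowLen_eq_of_forall_mem_iff fun j => by simp

theorem card_bot : (⊥ : YoungDiagram).card = 0 := rfl

theorem oddCols_bot : oddCols ⊥ = 0 := rfl

theorem interlaces_bot_iff {μ : YoungDiagram} : μ.Interlaces ⊥ ↔ μ = ⊥ := by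
  constructor
  · intro h
    exact ext_rowLen fun i => by
      have := (h i).1
      rw [rowLen_bot] at this ⊢
      omega
  · rintro rfl i
    simp [rowLen_bot]

/-- The local rule of the Robinson-Schensted-Knuth correspondence: for diagrams `α`, `β`, it relates
the diagrams `lam` above both to the pairs of a number `k` and a diagram `ρ` below both. -/
structure LocalRule (α β lam : YoungDiagram) (k : ℕ) (ρ : YoungDiagram) : Prop where
  left_above : α.Interlaces lam
  right_above : β.Interlaces lam
  below_left : ρ.Interlaces α
  below_right : ρ.Interlaces β
  zero : lam.rowLen 0 = max (α.rowLen 0) (β.rowLen 0) + k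
  succ : ∀ i, lam.rowLen (i + 1) + ρ.rowLen i =
    max (α.rowLen (i + 1)) (β.rowLen (i + 1)) + min (α.rowLen i) (β.rowLen i)

namespace LocalRule

variable {α β lam ρ : YoungDiagram} {k : ℕ}

theorem below_unique {k' : ℕ} {ρ' : YoungDiagram} (h : LocalRule α β lam k ρ)
    (h' : LocalRule α β lam k' ρ') : k = k' ∧ ρ = ρ' := by
  refine ⟨?_, ext_rowLen fun i => ?_⟩
  · have := h.zero
    have := h'.zero
    omega
  · have := h.succ i
    have := h'.succ i
    omega

theorem above_unique {lam' : YoungDiagram} (h : LocalRule α β lam k ρ)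
    (h' : LocalRule α β lam' k ρ) : lam = lam' := by
  refine ext_rowLen fun i => ?_
  cases i with
  | zero => rw [h.zero, h'.zero]
  | succ i =>
    have := h.succ i
    have := h'.succ i
    omega

theorem exists_below (hα : α.Interlaces lam) (hβ : β.Interlaces lam) :
    ∃ k ρ, LocalRule α β lam k ρ := by
  obtain ⟨M, hM⟩ := lam.exists_forall_rowLen_eq_zero
  obtain ⟨ρ, hρ⟩ := exists_rowLen_eq (M := M)
    (f := fun i => max (α.rowLen (i + 1)) (β.rowLen (i + 1)) + min (α.rowLen i) (β.rowLen i)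
      - lam.rowLen (i + 1))
    (antitone_nat_of_succ_le fun i => by
      have := hα i; have := hα (i + 1); have := hα (i + 1 + 1)
      have := hβ i; have := hβ (i + 1); have := hβ (i + 1 + 1)
      omega)
    (by
      have := hα M; have := hα (M + 1); have := hM M le_rfl; have := hM (M + 1) (by omega)
      have := hβ M; have := hβ (M + 1)
      omega)
  refine ⟨lam.rowLen 0 - max (α.rowLen 0) (β.rowLen 0), ρ, hα, hβ, fun i => ?_, fun i => ?_, ?_,
    fun i => ?_⟩
  · rw [hρ]
    have := hα i; have := hα (i + 1); have := hβ i; have := hβ (i + 1)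
    omega
  · rw [hρ]
    have := hα i; have := hα (i + 1); have := hβ i; have := hβ (i + 1)
    omega
  · have := hα 0; have := hβ 0
    omega
  · rw [hρ]
    have := hα i; have := hα (i + 1); have := hβ i; have := hβ (i + 1)
    omega

theorem exists_above (k : ℕ) (hα : ρ.Interlaces α) (hβ : ρ.Interlaces β) :
    ∃ lam, LocalRule α β lam k ρ := by
  obtain ⟨M, hM⟩ := α.exists_forall_rowLen_eq_zero
  obtain ⟨M', hM'⟩ := β.exists_forall_rowLen_eq_zero
  obtain ⟨lam, hl⟩ := exists_rowLen_eq (M := M + M' + 1)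
    (f := fun i => match i with
      | 0 => max (α.rowLen 0) (β.rowLen 0) + k
      | i + 1 =>
        max (α.rowLen (i + 1)) (β.rowLen (i + 1)) + min (α.rowLen i) (β.rowLen i) - ρ.rowLen i)
    (antitone_nat_of_succ_le fun i => by
      cases i with
      | zero =>
        have := hα 0; have := hβ 0
        dsimp only
        omega
      | succ i =>
        have := hα i; have := hα (i + 1)
        have := hβ i; have := hβ (i + 1)
        dsimp only
        omega)
    (by
      have := hM (M + M') (by omega); have := hM (M + M' + 1) (by omega)
      have := hM' (M + M') (by omega); have := hM' (M + M' + 1) (by omega)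
      dsimp only
      omega)
  have hl0 := hl 0
  have hls := fun i => hl (i + 1)
  dsimp only at hl0 hls
  refine ⟨lam, fun i => ⟨?_, ?_⟩, fun i => ⟨?_, ?_⟩, hα, hβ, hl0, fun i => ?_⟩
  · cases i with
    | zero => rw [hl0]; omega
    | succ i => have := hls i; have := hα i; have := hβ i; omega
  · have := hls i; have := hα i; have := hβ i; omega
  · cases i with
    | zero => rw [hl0]; omega
    | succ i => have := hls i; have := hα i; have := hβ i; omega
  · have := hls i; have := hα i; have := hβ i; omega
  · have := hls i; have := hα i; have := hβ i; omega

theorem exists_forall_rowLen_eq_zero (h : LocalRule α β lam k ρ) :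
    ∃ M, lam.rowLen (M + 1) = 0 ∧ α.rowLen M = 0 ∧ β.rowLen M = 0 ∧ ρ.rowLen M = 0 := by
  obtain ⟨M, hM⟩ := lam.exists_forall_rowLen_eq_zero
  have := hM M le_rfl
  have := h.left_above M
  have := h.right_above M
  have := h.below_left M
  exact ⟨M, hM _ (by omega), by omega, by omega, by omega⟩

theorem card_add_card (h : LocalRule α β lam k ρ) : lam.card + ρ.card = k + α.card + β.card := by
  obtain ⟨M, hl, hα, hβ, hρ⟩ := h.exists_forall_rowLen_eq_zero
  rw [card_eq_sum_rowLen _ hl, card_eq_sum_rowLen _ hα, card_eq_sum_rowLen _ hβ,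
    card_eq_sum_rowLen _ hρ]
  have key : ∀ n, ∑ i ∈ Finset.range (n + 1), lam.rowLen i + ∑ i ∈ Finset.range n, ρ.rowLen i
      = k + ∑ i ∈ Finset.range n, α.rowLen i + ∑ i ∈ Finset.range n, β.rowLen i
        + max (α.rowLen n) (β.rowLen n) := by
    intro n
    induction n with
    | zero => simp [h.zero, add_comm]
    | succ n ih =>
      rw [Finset.sum_range_succ lam.rowLen]
      simp only [Finset.sum_range_succ _ n] at ih ⊢
      have := h.succ n
      omega
  have := key M
  omega

theorem oddCols_eq (h : LocalRule α α lam k ρ) : oddCols lam = oddCols ρ + k := by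
  obtain ⟨M, hl, hα, -, hρ⟩ := h.exists_forall_rowLen_eq_zero
  have key : ∀ n, ∑ i ∈ Finset.range (n + 1), (-1) ^ i * (lam.rowLen i : ℤ)
      = ∑ i ∈ Finset.range n, (-1) ^ i * (ρ.rowLen i : ℤ) + k + (-1) ^ n * (α.rowLen n : ℤ) := by
    intro n
    induction n with
    | zero => simp [h.zero, add_comm]
    | succ n ih =>
      rw [Finset.sum_range_succ, ih, Finset.sum_range_succ _ n]
      have hn := h.succ n
      rw [max_self, min_self] at hn
      have hn' : (lam.rowLen (n + 1) : ℤ) = α.rowLen (n + 1) + α.rowLen n - ρ.rowLen n := by omega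
      rw [hn']
      ring
  have hM := key M
  rw [← oddCols_eq_sum _ hl, ← oddCols_eq_sum _ hρ, hα] at hM
  simp only [Nat.cast_zero, mul_zero, add_zero] at hM
  exact_mod_cast hM

end LocalRule

end YoungDiagram

theorem Nat.sum_antidiagonal_multichoose_mul (a b n : ℕ) :
    ∑ p ∈ Finset.HasAntidiagonal.antidiagonal n, a.multichoose p.1 * b.multichoose p.2
      = (a + b).multichoose n := by
  induction a generalizing n with
  | zero =>
    cases n with
    | zero => simp
    | succ n => simp [Finset.Nat.sum_antidiagonal_succ]
  | succ a iha =>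
    induction n with
    | zero => simp
    | succ n ihn =>
      rw [show a + 1 + b = a + b + 1 by omega] at ihn ⊢
      rw [Nat.multichoose_succ_succ, ← iha, ← ihn]
      simp only [Finset.Nat.sum_antidiagonal_succ, Nat.multichoose_succ_succ, add_mul,
        Finset.sum_add_distrib, Nat.multichoose_zero_right, add_assoc]

theorem Nat.sum_antidiagonal_multichoose (a n : ℕ) :
    ∑ p ∈ Finset.HasAntidiagonal.antidiagonal n, a.multichoose p.1 = (a + 1).multichoose n := by
  simpa using Nat.sum_antidiagonal_multichoose_mul a 1 n

/-- The Iverson bracket with values in the extended nonnegative reals. -/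
def iverson (p : Prop) : ℝ≥0∞ := if p then 1 else 0

theorem iverson_true {p : Prop} (h : p) : iverson p = 1 := if_pos h

theorem iverson_false {p : Prop} (h : ¬p) : iverson p = 0 := if_neg h

theorem iverson_and (p q : Prop) : iverson (p ∧ q) = iverson p * iverson q := by
  by_cases hp : p <;> by_cases hq : q <;> simp [iverson, hp, hq]

theorem iverson_mul_iverson_mul_self (p : Prop) (a : ℝ≥0∞) :
    iverson p * (iverson p * a) = iverson p * a := by
  rw [← mul_assoc, ← iverson_and, and_self]

theorem iverson_congr {p q : Prop} (h : p ↔ q) : iverson p = iverson q := by rw [propext h]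

theorem tsum_iverson_of_unique {Y : Type*} {p : Y → Prop} (h : ∀ y y', p y → p y' → y = y') :
    ∑' y, iverson (p y) = iverson (∃ y, p y) := by
  by_cases hp : ∃ y, p y
  · obtain ⟨y, hy⟩ := hp
    rw [tsum_eq_single y fun y' hy' => iverson_false fun h' => hy' (h _ _ h' hy),
      iverson_true hy, iverson_true ⟨y, hy⟩]
  · rw [iverson_false hp]
    exact ENNReal.tsum_eq_zero.2 fun y => iverson_false fun hy => hp ⟨y, hy⟩

theorem tsum_iverson_mul_of_biUnique {X Y : Type*} {R : X → Y → Prop} (hR : Relator.BiUnique R)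
    {F : X → ℝ≥0∞} {G : Y → ℝ≥0∞} (h : ∀ x y, R x y → F x = G y) :
    ∑' x, iverson (∃ y, R x y) * F x = ∑' y, iverson (∃ x, R x y) * G y := by
  have hX : ∀ x, iverson (∃ y, R x y) * F x = ∑' y, iverson (R x y) * F x := fun x => by
    rw [ENNReal.tsum_mul_right, tsum_iverson_of_unique fun y y' => @hR.2 x y y']
  have hY : ∀ y, iverson (∃ x, R x y) * G y = ∑' x, iverson (R x y) * G y := fun y => by
    rw [ENNReal.tsum_mul_right, tsum_iverson_of_unique fun x x' hx hx' => hR.1 hx hx']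
  simp_rw [hX, hY]
  rw [ENNReal.tsum_comm]
  refine tsum_congr fun y => tsum_congr fun x => ?_
  by_cases hxy : R x y
  · rw [h x y hxy]
  · rw [iverson_false hxy, zero_mul, zero_mul]

theorem tsum_mul_tsum_mul_comm {X Y : Type*} (F : X → ℝ≥0∞) (H : X → Y → ℝ≥0∞) (c : Y → ℝ≥0∞) :
    ∑' x, F x * ∑' y, H x y * c y = ∑' y, c y * ∑' x, H x y * F x := by
  simp_rw [← ENNReal.tsum_mul_left]
  rw [ENNReal.tsum_comm]
  exact tsum_congr fun y => tsum_congr fun x => by ring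

theorem tsum_tsum_iverson_add_eq (n : ℕ) (f : ℕ → ℕ → ℝ≥0∞) :
    ∑' a, ∑' b, iverson (a + b = n) * f a b = ∑ p ∈ Finset.HasAntidiagonal.antidiagonal n, f p.1 p.2 := by
  rw [← ENNReal.tsum_prod (f := fun a b => iverson (a + b = n) * f a b),
    tsum_eq_sum (s := Finset.HasAntidiagonal.antidiagonal n) fun p hp => by
      rw [iverson_false fun h => hp (Finset.HasAntidiagonal.mem_antidiagonal.2 h), zero_mul]]
  exact Finset.sum_congr rfl fun p hp => by
    rw [iverson_true (Finset.HasAntidiagonal.mem_antidiagonal.1 hp), one_mul]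

namespace YoungDiagram

theorem tsum_localRule (α β : YoungDiagram) {F : YoungDiagram → ℝ≥0∞}
    {G : ℕ → YoungDiagram → ℝ≥0∞}
    (h : ∀ lam k ρ, LocalRule α β lam k ρ → F lam = G k ρ) :
    ∑' lam, iverson (α.Interlaces lam) * (iverson (β.Interlaces lam) * F lam)
      = ∑' k, ∑' ρ, iverson (ρ.Interlaces α) * (iverson (ρ.Interlaces β) * G k ρ) := by
  have key := tsum_iverson_mul_of_biUnique
    (R := fun lam (p : ℕ × YoungDiagram) => LocalRule α β lam p.1 p.2) (F := F)
    (G := fun p => G p.1 p.2)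
    ⟨fun _ _ _ h h' => h.above_unique h', fun _ _ _ h h' =>
      Prod.ext (h.below_unique h').1 (h.below_unique h').2⟩
    fun lam p hp => h lam p.1 p.2 hp
  rw [ENNReal.tsum_prod'] at key
  simp_rw [← mul_assoc, ← iverson_and]
  calc _ = _ := tsum_congr fun lam => ?_
    _ = _ := key
    _ = _ := tsum_congr fun k => tsum_congr fun ρ => ?_
  · congr 1
    refine iverson_congr ⟨fun h => ?_, ?_⟩
    · obtain ⟨k, ρ, hk⟩ := LocalRule.exists_below h.1 h.2
      exact ⟨(k, ρ), hk⟩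
    · rintro ⟨p, hp⟩
      exact ⟨hp.left_above, hp.right_above⟩
  · congr 1
    refine iverson_congr ⟨?_, fun h => LocalRule.exists_above k h.1 h.2⟩
    rintro ⟨lam, hl⟩
    exact ⟨hl.below_left, hl.below_right⟩

end YoungDiagram

namespace SSYTN

open YoungDiagram

variable {n : ℕ} {lam μ : YoungDiagram}

theorem le (T : SSYTN n lam) {i j : ℕ} (h : (i, j) ∈ lam) : T.1 i j ≤ n :=
  (Finset.mem_Icc.1 (T.2 i j h)).2

theorem one_le (T : SSYTN n lam) {i j : ℕ} (h : (i, j) ∈ lam) : 1 ≤ T.1 i j :=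
  (Finset.mem_Icc.1 (T.2 i j h)).1

/-- The diagram of the cells of a tableau with entries at most `n`. -/
def innerShape (T : SSYTN (n + 1) lam) : YoungDiagram where
  cells := lam.cells.filter fun c => T.1 c.1 c.2 ≤ n
  isLowerSet := by
    rintro ⟨a, b⟩ ⟨c, d⟩ hcd hab
    obtain ⟨h1, h2⟩ := Prod.mk_le_mk.1 hcd
    rw [Finset.mem_coe, Finset.mem_filter, mem_cells] at hab ⊢
    have hcb := lam.up_left_mem h1 le_rfl hab.1
    exact ⟨lam.up_left_mem h1 h2 hab.1,
      (T.1.row_weak_of_le h2 hcb).trans ((T.1.col_weak h1 hab.1).trans hab.2)⟩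

theorem mem_innerShape {T : SSYTN (n + 1) lam} {i j : ℕ} :
    (i, j) ∈ T.innerShape ↔ (i, j) ∈ lam ∧ T.1 i j ≤ n :=
  Finset.mem_filter

theorem innerShape_interlaces (T : SSYTN (n + 1) lam) : T.innerShape.Interlaces lam := by
  refine fun i => ⟨not_lt.1 fun hlt => ?_, not_lt.1 fun hlt => ?_⟩
  · exact lt_irrefl _ (mem_iff_lt_rowLen.1 (mem_innerShape.1 (mem_iff_lt_rowLen.2 hlt)).1)
  · have h := mem_iff_lt_rowLen.2 hlt
    have h1 := T.1.col_strict (Nat.lt_add_one i) h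
    have h2 := T.le h
    exact lt_irrefl _ (mem_iff_lt_rowLen.1
      (mem_innerShape.2 ⟨lam.up_left_mem (Nat.le_succ i) le_rfl h, by omega⟩))

/-- Extend a tableau by the entry `n + 1` on a horizontal strip. -/
def extend (h : μ.Interlaces lam) (T : SSYTN n μ) : SSYTN (n + 1) lam :=
  have hle : ∀ {i j}, (i, j) ∈ μ → (i, j) ∈ lam := fun {i j} hij =>
    mem_iff_lt_rowLen.2 ((mem_iff_lt_rowLen.1 hij).trans_le (h i).1)
  ⟨{ entry := fun i j => if (i, j) ∈ μ then T.1 i j else if (i, j) ∈ lam then n + 1 else 0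
     row_weak' := fun {i j1 j2} hj hc => by
      by_cases h2 : (i, j2) ∈ μ
      · rw [if_pos h2, if_pos (μ.up_left_mem le_rfl hj.le h2)]
        exact T.1.row_weak hj h2
      · rw [if_neg h2, if_pos hc]
        split_ifs with h1
        · exact (T.le h1).trans (Nat.le_succ n)
        · exact le_rfl
        · exact Nat.zero_le _
     col_strict' := fun {i1 i2 j} hi hc => by
      have h1 : (i1, j) ∈ μ := mem_iff_lt_rowLen.2
        ((mem_iff_lt_rowLen.1 (lam.up_left_mem hi le_rfl hc)).trans_le (h i1).2)
      rw [if_pos h1]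
      by_cases h2 : (i2, j) ∈ μ
      · rw [if_pos h2]
        exact T.1.col_strict hi h2
      · rw [if_neg h2, if_pos hc]
        exact Nat.lt_succ_of_le (T.le h1)
     zeros' := fun {i j} hc => by rw [if_neg fun h' => hc (hle h'), if_neg hc] },
   fun i j hc => by
    change (if (i, j) ∈ μ then T.1 i j else if (i, j) ∈ lam then n + 1 else 0) ∈ _
    rw [Finset.mem_Icc]
    by_cases h2 : (i, j) ∈ μ
    · rw [if_pos h2]
      exact ⟨T.one_le h2, (T.le h2).trans (Nat.le_succ n)⟩
    · rw [if_neg h2, if_pos hc]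
      omega⟩

theorem extend_apply (h : μ.Interlaces lam) (T : SSYTN n μ) (i j : ℕ) :
    (extend h T).1 i j = if (i, j) ∈ μ then T.1 i j else if (i, j) ∈ lam then n + 1 else 0 :=
  rfl

theorem innerShape_extend (h : μ.Interlaces lam) (T : SSYTN n μ) :
    (extend h T).innerShape = μ := by
  ext ⟨i, j⟩
  rw [mem_cells, mem_cells, mem_innerShape, extend_apply]
  constructor
  · rintro ⟨h1, h2⟩
    by_contra h3
    rw [if_neg h3, if_pos h1] at h2
    omega
  · intro h3
    rw [if_pos h3]
    exact ⟨mem_iff_lt_rowLen.2 ((mem_iff_lt_rowLen.1 h3).trans_le (h i).1), T.le h3⟩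

/-- The restriction of a tableau to the cells with entries at most `n`. -/
def restrict (T : SSYTN (n + 1) lam) (hT : T.innerShape = μ) : SSYTN n μ :=
  have hmem : ∀ {i j}, (i, j) ∈ μ → (i, j) ∈ lam ∧ T.1 i j ≤ n := fun {i j} h =>
    mem_innerShape.1 (hT.symm ▸ h)
  ⟨{ entry := fun i j => if (i, j) ∈ μ then T.1 i j else 0
     row_weak' := fun {i j1 j2} hj hc => by
      rw [if_pos hc, if_pos (μ.up_left_mem le_rfl hj.le hc)]
      exact T.1.row_weak hj (hmem hc).1
     col_strict' := fun {i1 i2 j} hi hc => by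
      rw [if_pos hc, if_pos (μ.up_left_mem hi.le le_rfl hc)]
      exact T.1.col_strict hi (hmem hc).1
     zeros' := fun hc => if_neg hc },
   fun i j hc => by
    change (if (i, j) ∈ μ then T.1 i j else 0) ∈ _
    rw [if_pos hc, Finset.mem_Icc]
    exact ⟨T.one_le (hmem hc).1, (hmem hc).2⟩⟩

theorem restrict_apply (T : SSYTN (n + 1) lam) (hT : T.innerShape = μ) (i j : ℕ) :
    (T.restrict hT).1 i j = if (i, j) ∈ μ then T.1 i j else 0 :=
  rfl

/-- Tableaux whose inner shape is `μ` are tableaux of shape `μ`. -/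
def fiberEquiv (h : μ.Interlaces lam) :
    {T : SSYTN (n + 1) lam // T.innerShape = μ} ≃ SSYTN n μ where
  toFun T := T.1.restrict T.2
  invFun T := ⟨extend h T, innerShape_extend h T⟩
  left_inv := by
    rintro ⟨T, hT⟩
    refine Subtype.ext (Subtype.ext (SemistandardYoungTableau.ext fun i j => ?_))
    rw [extend_apply, restrict_apply]
    by_cases h1 : (i, j) ∈ μ
    · rw [if_pos h1, if_pos h1]
    · rw [if_neg h1]
      by_cases h2 : (i, j) ∈ lam
      · rw [if_pos h2]
        have h3 : n < T.1 i j := not_le.1 fun h3 => h1 (hT ▸ mem_innerShape.2 ⟨h2, h3⟩)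
        exact le_antisymm h3 (T.le h2)
      · rw [if_neg h2, T.1.zeros h2]
  right_inv T := by
    refine Subtype.ext (SemistandardYoungTableau.ext fun i j => ?_)
    rw [restrict_apply, extend_apply]
    by_cases h1 : (i, j) ∈ μ
    · rw [if_pos h1, if_pos h1]
    · rw [if_neg h1, T.1.zeros h1]

/-- The number of tableaux, as an extended nonnegative real. -/
def count (n : ℕ) (lam : YoungDiagram) : ℝ≥0∞ := ∑' _ : SSYTN n lam, 1

theorem count_zero (lam : YoungDiagram) : count 0 lam = iverson (lam = ⊥) := by
  by_cases h : lam = ⊥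
  · subst h
    let T : SSYTN 0 ⊥ := ⟨⟨fun _ _ => 0, fun _ h => (notMem_bot _ h).elim,
      fun _ h => (notMem_bot _ h).elim, fun _ => rfl⟩, fun i j h => (notMem_bot _ h).elim⟩
    have huniq : ∀ T', T' = T := fun T' => Subtype.ext (SemistandardYoungTableau.ext fun i j => by
      rw [T'.1.zeros (notMem_bot _)]
      rfl)
    rw [iverson_true rfl, count, tsum_eq_single T fun T' hT' => (hT' (huniq T')).elim]
  · rw [iverson_false h, count]
    have : IsEmpty (SSYTN 0 lam) := ⟨fun T => h <| by
      ext ⟨i, j⟩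
      rw [mem_cells, mem_cells]
      refine ⟨fun hc => ?_, fun hc => (notMem_bot _ hc).elim⟩
      have := T.one_le hc
      have := T.le hc
      omega⟩
    exact tsum_empty

theorem count_succ (n : ℕ) (lam : YoungDiagram) :
    count (n + 1) lam = ∑' μ : YoungDiagram, iverson (μ.Interlaces lam) * count n μ := by
  rw [count, ← (Equiv.sigmaFiberEquiv (innerShape (n := n) (lam := lam))).tsum_eq,
    ENNReal.tsum_sigma']
  refine tsum_congr fun μ => ?_
  by_cases h : μ.Interlaces lam
  · rw [iverson_true h, one_mul, count, ← (fiberEquiv h).tsum_eq]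
  · rw [iverson_false h, zero_mul]
    exact ENNReal.tsum_eq_zero.2 fun T => (h (T.2 ▸ innerShape_interlaces T.1)).elim

end SSYTN

namespace SSYTN

open YoungDiagram

/-- The Pieri rule for multiplication by a complete homogeneous symmetric function, at the level of
numbers of tableaux. -/
theorem tsum_count_of_interlaces (n : ℕ) (ν : YoungDiagram) (d : ℕ) :
    ∑' lam, iverson (ν.Interlaces lam) * iverson (lam.card = ν.card + d) * count n lam
      = n.multichoose d * count n ν := by
  induction n generalizing ν d with
  | zero =>
    simp_rw [count_zero]
    rw [tsum_eq_single ⊥ fun lam hl => by rw [iverson_false hl, mul_zero], iverson_true rfl,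
      mul_one, ← iverson_and]
    by_cases hν : ν = ⊥
    · subst hν
      cases d with
      | zero =>
        rw [iverson_true ⟨interlaces_bot_iff.2 rfl, rfl⟩]
        simp [iverson_true]
      | succ d =>
        rw [iverson_false fun h => by have := h.2; omega]
        simp
    · rw [iverson_false fun h => hν (interlaces_bot_iff.1 h.1), iverson_false hν, mul_zero]
  | succ n ih =>
    have hG : ∀ α ρ : YoungDiagram, ∀ k, iverson (ρ.Interlaces α) *
        iverson (k + α.card = ρ.card + d) = ∑' e, iverson (k + e = d) *
          (iverson (ρ.Interlaces α) * iverson (α.card = ρ.card + e)) := by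
      intro α ρ k
      by_cases h : ρ.Interlaces α
      · obtain ⟨e, he⟩ := Nat.exists_eq_add_of_le h.card_le
        rw [iverson_true h, one_mul, tsum_eq_single e fun e' he' => by
          rw [iverson_false (p := α.card = ρ.card + e') (by omega), mul_zero, mul_zero],
          iverson_true he, mul_one, mul_one]
        exact iverson_congr (by omega)
      · simp [iverson_false h]
    calc ∑' lam, iverson (ν.Interlaces lam) * iverson (lam.card = ν.card + d) * count (n + 1) lam
        = ∑' α, count n α * ∑' lam, iverson (α.Interlaces lam) *
            (iverson (ν.Interlaces lam) * iverson (lam.card = ν.card + d)) := by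
          simp_rw [count_succ]
          exact tsum_mul_tsum_mul_comm _ _ _
      _ = ∑' α, count n α * ∑' k, ∑' ρ : YoungDiagram, iverson (ρ.Interlaces α) *
            (iverson (ρ.Interlaces ν) * iverson (k + α.card = ρ.card + d)) := by
          refine tsum_congr fun α => ?_
          rw [tsum_localRule α ν (G := fun k ρ => iverson (k + α.card = ρ.card + d))]
          intro lam k ρ h
          have := h.card_add_card
          exact iverson_congr (by omega)
      _ = ∑' α, ∑' ρ : YoungDiagram, ∑' k, count n α * (iverson (ρ.Interlaces α) *
            (iverson (ρ.Interlaces ν) * iverson (k + α.card = ρ.card + d))) := by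
          refine tsum_congr fun α => ?_
          rw [ENNReal.tsum_comm]
          simp_rw [ENNReal.tsum_mul_left]
      _ = ∑' ρ : YoungDiagram, ∑' k, ∑' α, iverson (ρ.Interlaces ν) *
            (iverson (ρ.Interlaces α) * iverson (k + α.card = ρ.card + d) * count n α) := by
          rw [ENNReal.tsum_comm]
          refine tsum_congr fun ρ => ?_
          rw [ENNReal.tsum_comm]
          exact tsum_congr fun k => tsum_congr fun α => by ring
      _ = ∑' ρ : YoungDiagram, iverson (ρ.Interlaces ν) * ∑' k, ∑' e, iverson (k + e = d) *
            ∑' α, iverson (ρ.Interlaces α) * iverson (α.card = ρ.card + e) * count n α := by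
          refine tsum_congr fun ρ => ?_
          rw [← ENNReal.tsum_mul_left]
          refine tsum_congr fun k => ?_
          rw [ENNReal.tsum_mul_left]
          congr 1
          simp_rw [hG, ← ENNReal.tsum_mul_right, ← ENNReal.tsum_mul_left]
          rw [ENNReal.tsum_comm]
          exact tsum_congr fun e => tsum_congr fun α => by ring
      _ = (n + 1).multichoose d * count (n + 1) ν := by
          rw [count_succ, ← ENNReal.tsum_mul_left]
          refine tsum_congr fun ρ => ?_
          simp_rw [ih]
          rw [tsum_tsum_iverson_add_eq d fun _ e => (n.multichoose e : ℝ≥0∞) * count n ρ,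
            ← Finset.sum_mul, ← Nat.sum_antidiagonal_multichoose,
            ← Finset.Nat.sum_antidiagonal_swap]
          push_cast
          simp only [Prod.snd_swap]
          ring

/-- The number of tableaux with a given size and number of odd columns, as an extended nonnegative
real. -/
def countOdd (n j m : ℕ) : ℝ≥0∞ :=
  ∑' lam : YoungDiagram, iverson (lam.card = 2 * j + m) * iverson (oddCols lam = m) * count n lam

theorem countOdd_succ (n j m : ℕ) :
    countOdd (n + 1) j m = ∑' k, ∑' m', iverson (k + m' = m) *
      ∑' i, ∑' d, iverson (i + d = j) * (n.multichoose d * countOdd n i m') := by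
  have hG : ∀ μ ν : YoungDiagram, ∀ k, iverson (ν.Interlaces μ) *
      (iverson (2 * μ.card + k = ν.card + 2 * j + m) * iverson (oddCols ν + k = m))
      = ∑' p : ℕ × ℕ × ℕ, iverson (k + p.1 = m) * (iverson (p.2.1 + p.2.2 = j) *
        ((iverson (ν.card = 2 * p.2.1 + p.1) * iverson (oddCols ν = p.1)) *
          (iverson (ν.Interlaces μ) * iverson (μ.card = ν.card + p.2.2)))) := by
    intro μ ν k
    by_cases h : ν.Interlaces μ
    · obtain ⟨d, hd⟩ := Nat.exists_eq_add_of_le h.card_le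
      obtain ⟨i, hi⟩ := ν.exists_card_eq_two_mul_add_oddCols
      rw [tsum_eq_single (oddCols ν, i, d)]
      · dsimp only
        rw [iverson_true h, iverson_true hd, iverson_true hi, iverson_true rfl]
        simp only [one_mul, mul_one]
        rw [← iverson_and, ← iverson_and]
        exact iverson_congr (by omega)
      · rintro ⟨m', i', d'⟩ hne
        simp only [← iverson_and]
        refine iverson_false fun hp => hne ?_
        simp only [Prod.mk.injEq]
        omega
    · simp [iverson_false h]
  calc countOdd (n + 1) j m
      = ∑' μ, count n μ * ∑' lam, iverson (μ.Interlaces lam) *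
          (iverson (lam.card = 2 * j + m) * iverson (oddCols lam = m)) := by
        simp_rw [countOdd, count_succ]
        exact tsum_mul_tsum_mul_comm _ _ _
    _ = ∑' μ, count n μ * ∑' lam, iverson (μ.Interlaces lam) * (iverson (μ.Interlaces lam) *
          (iverson (lam.card = 2 * j + m) * iverson (oddCols lam = m))) := by
        simp_rw [iverson_mul_iverson_mul_self]
    _ = ∑' μ, count n μ * ∑' k, ∑' ν : YoungDiagram, iverson (ν.Interlaces μ) *
          (iverson (ν.Interlaces μ) *
            (iverson (2 * μ.card + k = ν.card + 2 * j + m) * iverson (oddCols ν + k = m))) := by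
        refine tsum_congr fun μ => congrArg _ ?_
        refine tsum_localRule μ μ fun lam k ρ h => ?_
        have h1 := h.card_add_card
        have h2 := h.oddCols_eq
        rw [← iverson_and, ← iverson_and]
        exact iverson_congr (by omega)
    _ = ∑' μ, count n μ * ∑' k, ∑' ν : YoungDiagram, iverson (ν.Interlaces μ) *
            (iverson (2 * μ.card + k = ν.card + 2 * j + m) * iverson (oddCols ν + k = m)) := by
        simp_rw [iverson_mul_iverson_mul_self]
    _ = ∑' k, ∑' p : ℕ × ℕ × ℕ, ∑' ν : YoungDiagram, ∑' μ,
          count n μ * (iverson (k + p.1 = m) * (iverson (p.2.1 + p.2.2 = j) *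
            ((iverson (ν.card = 2 * p.2.1 + p.1) * iverson (oddCols ν = p.1)) *
              (iverson (ν.Interlaces μ) * iverson (μ.card = ν.card + p.2.2))))) := by
        simp_rw [hG, ← ENNReal.tsum_mul_left]
        rw [ENNReal.tsum_comm]
        refine tsum_congr fun k => ?_
        rw [ENNReal.tsum_comm, ENNReal.tsum_comm (α := ℕ × ℕ × ℕ)]
        exact tsum_congr fun ν => ENNReal.tsum_comm
    _ = ∑' k, ∑' p : ℕ × ℕ × ℕ, iverson (k + p.1 = m) * (iverson (p.2.1 + p.2.2 = j) *
          (n.multichoose p.2.2 * countOdd n p.2.1 p.1)) := by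
        refine tsum_congr fun k => tsum_congr fun p => ?_
        simp_rw [countOdd, ← ENNReal.tsum_mul_left]
        refine tsum_congr fun ν => ?_
        have := tsum_count_of_interlaces n ν p.2.2
        rw [mul_left_comm _ _ (count n ν), ← this]
        simp_rw [← ENNReal.tsum_mul_left]
        exact tsum_congr fun μ => by ring
    _ = _ := by
        refine tsum_congr fun k => ?_
        rw [ENNReal.tsum_prod']
        refine tsum_congr fun m' => ?_
        rw [ENNReal.tsum_prod']
        simp_rw [ENNReal.tsum_mul_left]

theorem countOdd_eq (n j m : ℕ) :
    countOdd n j m = ((n * (n - 1) / 2).multichoose j * n.multichoose m : ℕ) := by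
  induction n generalizing j m with
  | zero =>
    simp_rw [countOdd, count_zero]
    rw [tsum_eq_single ⊥ fun lam hl => by rw [iverson_false hl, mul_zero], iverson_true rfl,
      mul_one, ← iverson_and, card_bot, oddCols_bot]
    rcases j with _ | j <;> rcases m with _ | m <;> simp [iverson]
  | succ n ih =>
    have htri : (n + 1) * (n + 1 - 1) / 2 = n * (n - 1) / 2 + n := by
      rw [← Finset.sum_range_id_mul_two, ← Finset.sum_range_id_mul_two, Nat.mul_div_cancel _ two_pos,
        Nat.mul_div_cancel _ two_pos, Finset.sum_range_succ]
    rw [countOdd_succ, htri, ← Nat.sum_antidiagonal_multichoose_mul,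
      ← Nat.sum_antidiagonal_multichoose, ← Finset.Nat.sum_antidiagonal_swap (n := m)]
    simp_rw [ih]
    have hin : ∀ m', ∑' i, ∑' d, iverson (i + d = j) * ((n.multichoose d : ℝ≥0∞) *
        ((n * (n - 1) / 2).multichoose i * n.multichoose m' : ℕ)) =
        (∑ p ∈ Finset.HasAntidiagonal.antidiagonal j,
          (n * (n - 1) / 2).multichoose p.1 * n.multichoose p.2 : ℕ) * n.multichoose m' := by
      intro m'
      rw [tsum_tsum_iverson_add_eq j fun i d => (n.multichoose d : ℝ≥0∞) *
        ((n * (n - 1) / 2).multichoose i * n.multichoose m' : ℕ)]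
      push_cast
      rw [Finset.sum_mul]
      exact Finset.sum_congr rfl fun p _ => by ring
    simp_rw [hin]
    rw [tsum_tsum_iverson_add_eq m fun _ m' => _ * (n.multichoose m' : ℝ≥0∞), ← Finset.mul_sum]
    push_cast
    rfl

end SSYTN

/-- `b(N,j,m,∞) = C(N(N-1)/2 + j - 1, j) · C(N + m - 1, m)`. -/
theorem bInf_eq_choose (N j m : ℕ) (hN : 0 < N) :
    bInf N j m = Nat.choose (N * (N - 1) / 2 + j - 1) j * Nat.choose (N + m - 1) m := by
  have hcard : ((ENat.card (Σ μ : {μ : YoungDiagram // μ.card = 2 * j + m ∧ oddCols μ = m},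
      SSYTN N μ.1) : ℕ∞) : ℝ≥0∞) = SSYTN.countOdd N j m := by
    rw [← ENNReal.tsum_one, ENNReal.tsum_sigma', SSYTN.countOdd,
      ← tsum_subtype_eq_of_support_subset
        (s := {μ : YoungDiagram | μ.card = 2 * j + m ∧ oddCols μ = m})]
    · refine tsum_congr fun μ => ?_
      rw [iverson_true μ.2.1, iverson_true μ.2.2, one_mul, one_mul]
      rfl
    · intro μ hμ
      by_contra h
      have h' : ¬(μ.card = 2 * j + m ∧ oddCols μ = m) := h
      exact hμ (by dsimp only; rw [← iverson_and, iverson_false h', zero_mul])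
  rw [SSYTN.countOdd_eq, ← ENat.toENNReal_coe, ENat.toENNReal_inj] at hcard
  rw [bInf, Nat.card, ← Nat.multichoose_eq, ← Nat.multichoose_eq]
  exact congrArg ENat.toNat hcard
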